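/- For any BMSC W with finite output alphabet, the convolutional polarization step is at least as strong as the polar one: I(W^{+̂}) ≥ I(W⁺), I(W^{-̂}) ≤ I(W⁻), and consequently I(W^{+̂}) − I(W^{-̂}) ≥ I(W⁺) − I(W⁻). -/

import Mathlib

open Finset

section Channels

variable {Y Y₁ Y₂ : Type*}

/-- A binary-input channel with finite output alphabet: nonnegative entries,
each row summing to one. -/
def IsChannel [Fintype Y] (W : ZMod 2 → Y → ℝ) : Prop :=
  (∀ x y, 0 ≤ W x y) ∧ ∀ x, ∑ y, W x y = 1

/-- A binary-input memoryless symmetric channel (BMSC): a channel admitting an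
involution of the output alphabet exchanging the two conditional distributions. -/
def IsBMSC [Fintype Y] (W : ZMod 2 → Y → ℝ) : Prop :=
  IsChannel W ∧ ∃ π : Y → Y, Function.Involutive π ∧ ∀ y, W 1 y = W 0 (π y)

/-- The Bhattacharyya parameter of a binary-input channel. -/
noncomputable def Zparam [Fintype Y] (W : ZMod 2 → Y → ℝ) : ℝ :=
  ∑ y, Real.sqrt (W 0 y * W 1 y)

/-- The symmetric capacity of a binary-input channel. -/
noncomputable def capacity [Fintype Y] (W : ZMod 2 → Y → ℝ) : ℝ :=
  ∑ x : ZMod 2, ∑ y, (1 / 2) * W x y *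
    Real.logb 2 (W x y / ((1 / 2) * (W 0 y + W 1 y)))

/-- The minus polar transform ⟨W₁,W₂⟩⁻. -/
noncomputable def polarMinus [Fintype Y₁] [Fintype Y₂] (W₁ : ZMod 2 → Y₁ → ℝ)
    (W₂ : ZMod 2 → Y₂ → ℝ) : ZMod 2 → Y₁ × Y₂ → ℝ :=
  fun u₁ y => (1 / 2) * ∑ u₂ : ZMod 2, W₁ (u₁ + u₂) y.1 * W₂ u₂ y.2

/-- The plus polar transform ⟨W₁,W₂⟩⁺, with output (y₁, y₂, u₁). -/
noncomputable def polarPlus [Fintype Y₁] [Fintype Y₂] (W₁ : ZMod 2 → Y₁ → ℝ)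
    (W₂ : ZMod 2 → Y₂ → ℝ) : ZMod 2 → Y₁ × Y₂ × ZMod 2 → ℝ :=
  fun u₂ y => (1 / 2) * W₁ (y.2.2 + u₂) y.1 * W₂ u₂ y.2.1

end Channels

/-- The minus bulk convolutional polar transform W^{-̂} = ⟨W⁻, W⁺⟩⁻. -/
noncomputable def convMinus {Y : Type*} [Fintype Y] (W : ZMod 2 → Y → ℝ) :
    ZMod 2 → (Y × Y) × (Y × Y × ZMod 2) → ℝ :=
  polarMinus (polarMinus W W) (polarPlus W W)

/-- The plus bulk convolutional polar transform W^{+̂} = ⟨W⁻, W⁺⟩⁺. -/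
noncomputable def convPlus {Y : Type*} [Fintype Y] (W : ZMod 2 → Y → ℝ) :
    ZMod 2 → (Y × Y) × (Y × Y × ZMod 2) × ZMod 2 → ℝ :=
  polarPlus (polarMinus W W) (polarPlus W W)

/-- One-term form of the log-sum inequality: the tangent bound at slope `c`. -/
lemma mul_log_div_ge {a t c : ℝ} (ha : 0 ≤ a) (ht : a ≤ 2 * t) (hc : 0 < c) :
    a * Real.log c + a - t * c ≤ a * Real.log (a / t) := by
  rcases ha.eq_or_lt with rfl | ha
  · simp only [zero_mul, zero_add, zero_sub, Left.neg_nonpos_iff]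
    have : 0 ≤ t := by linarith
    positivity
  · have ht : 0 < t := by linarith
    have h := mul_le_mul_of_nonneg_left
      (Real.log_le_sub_one_of_pos (show 0 < c / (a / t) by positivity)) ha.le
    rw [Real.log_div hc.ne' (by positivity)] at h
    have e : a * (c / (a / t) - 1) = t * c - a := by field_simp
    linarith

/-- The log-sum inequality. -/
lemma log_sum_inequality {ι : Type*} (s : Finset ι) (a t : ι → ℝ)
    (ha : ∀ i ∈ s, 0 ≤ a i) (ht : ∀ i ∈ s, a i ≤ 2 * t i) :
    (∑ i ∈ s, a i) * Real.logb 2 ((∑ i ∈ s, a i) / ∑ i ∈ s, t i) ≤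
      ∑ i ∈ s, a i * Real.logb 2 (a i / t i) := by
  simp only [Real.logb, ← mul_div_assoc, ← Finset.sum_div]
  gcongr
  rcases (Finset.sum_nonneg ha).eq_or_lt with hA | hA
  · rw [← hA, zero_mul]
    refine (Finset.sum_eq_zero fun i hi => ?_).ge
    rw [(Finset.sum_eq_zero_iff_of_nonneg ha).1 hA.symm i hi, zero_mul]
  · have hT : 0 < ∑ i ∈ s, t i := by
      have := Finset.sum_le_sum ht
      rw [← Finset.mul_sum] at this
      linarith
    have h := Finset.sum_le_sum fun i hi =>
      mul_log_div_ge (ha i hi) (ht i hi) (div_pos hA hT)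
    rw [Finset.sum_sub_distrib, Finset.sum_add_distrib, ← Finset.sum_mul, ← Finset.sum_mul,
      mul_div_cancel₀ _ hT.ne'] at h
    linarith

/-- Data processing: merging output letters does not increase the symmetric capacity. -/
lemma capacity_le_of_fiberwise_sum {Y Z : Type*} [Fintype Y] [Fintype Z] [DecidableEq Y]
    {W : ZMod 2 → Y → ℝ} {V : ZMod 2 → Z → ℝ} (hV : ∀ x z, 0 ≤ V x z) (e : Z → Y)
    (hW : ∀ x y, W x y = ∑ z with e z = y, V x z) : capacity W ≤ capacity V := by
  refine Finset.sum_le_sum fun x _ => ?_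
  rw [← Finset.sum_fiberwise univ e]
  refine Finset.sum_le_sum fun y _ => ?_
  simp only [mul_assoc, ← Finset.mul_sum]
  rw [hW 0, hW 1, hW x, ← Finset.sum_add_distrib, Finset.mul_sum]
  gcongr
  refine log_sum_inequality _ _ _ (fun z _ => hV x z) fun z _ => ?_
  have h0 := hV 0 z
  have h1 := hV 1 z
  fin_cases x
  · change V 0 z ≤ _
    linarith
  · change V 1 z ≤ _
    linarith

section PolarTransforms

variable {Y₁ Y₂ : Type*} [Fintype Y₁] [Fintype Y₂]
  {W₁ : ZMod 2 → Y₁ → ℝ} {W₂ : ZMod 2 → Y₂ → ℝ}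

/-- The channel `W₁` whose input is masked by a uniform bit `u`, where `u` is revealed at the
output together with the output of `W₂` on input `u`. -/
noncomputable def maskedChannel (W₁ : ZMod 2 → Y₁ → ℝ) (W₂ : ZMod 2 → Y₂ → ℝ) :
    ZMod 2 → (Y₁ × Y₂) × ZMod 2 → ℝ :=
  fun x z => (1 / 2) * (W₁ (x + z.2) z.1.1 * W₂ z.2 z.1.2)

lemma capacity_maskedChannel (h₂ : IsChannel W₂) :
    capacity (maskedChannel W₁ W₂) = capacity W₁ := by
  have key (x u : ZMod 2) (y₁ : Y₁) (y₂ : Y₂) :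
      (1 / 2) * maskedChannel W₁ W₂ x ((y₁, y₂), u) *
        Real.logb 2 (maskedChannel W₁ W₂ x ((y₁, y₂), u) /
          ((1 / 2) * (maskedChannel W₁ W₂ 0 ((y₁, y₂), u) +
            maskedChannel W₁ W₂ 1 ((y₁, y₂), u)))) =
      (1 / 2) * W₂ u y₂ * ((1 / 2) * W₁ (x + u) y₁ *
        Real.logb 2 (W₁ (x + u) y₁ / ((1 / 2) * (W₁ 0 y₁ + W₁ 1 y₁)))) := by
    have hs : W₁ (0 + u) y₁ + W₁ (1 + u) y₁ = W₁ 0 y₁ + W₁ 1 y₁ := by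
      fin_cases u
      · rfl
      · exact add_comm _ _
    simp only [maskedChannel]
    rcases eq_or_ne (W₂ u y₂) 0 with h | h
    · simp [h]
    · rw [← mul_add, ← add_mul, hs, ← mul_div_mul_left (W₁ (x + u) y₁) _
        (show 1 / 2 * W₂ u y₂ ≠ 0 by positivity)]
      ring_nf
  have inner (u : ZMod 2) (c : Y₁ → ℝ) :
      ∑ y₁, ∑ y₂, (1 / 2) * W₂ u y₂ * c y₁ = (1 / 2) * ∑ y₁, c y₁ := by
    simp only [← Finset.sum_mul, ← Finset.mul_sum, h₂.2, mul_one]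
  simp only [capacity, Fintype.sum_prod_type_right (γ := ℝ) (α₂ := ZMod 2)]
  simp only [Fintype.sum_prod_type, key, inner]
  rw [Finset.sum_comm]
  have shift (u : ZMod 2) (g : ZMod 2 → ℝ) : ∑ x, g (x + u) = ∑ x, g x :=
    Equiv.sum_comp (Equiv.addRight u) g
  simp only [← Finset.mul_sum]
  rw [Finset.sum_congr rfl fun u _ => shift u fun x => ∑ y₁, (1 / 2) * W₁ x y₁ *
    Real.logb 2 (W₁ x y₁ / ((1 / 2) * (W₁ 0 y₁ + W₁ 1 y₁)))]
  simp

lemma capacity_polarMinus_le (h₁ : IsChannel W₁) (h₂ : IsChannel W₂) :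
    capacity (polarMinus W₁ W₂) ≤ capacity W₁ := by
  classical
  rw [← capacity_maskedChannel (W₁ := W₁) h₂]
  refine capacity_le_of_fiberwise_sum (fun x z => ?_) Prod.fst fun x y => ?_
  · have := h₁.1 (x + z.2) z.1.1
    have := h₂.1 z.2 z.1.2
    unfold maskedChannel
    positivity
  · rw [Finset.sum_filter, Fintype.sum_prod_type_right]
    simp [polarMinus, maskedChannel, Finset.mul_sum]

lemma polarPlus_nonneg (h₁ : IsChannel W₁) (h₂ : IsChannel W₂) (x : ZMod 2)
    (z : Y₁ × Y₂ × ZMod 2) : 0 ≤ polarPlus W₁ W₂ x z := by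
  have := h₁.1 (z.2.2 + x) z.1
  have := h₂.1 x z.2.1
  unfold polarPlus
  positivity

lemma sum_polarPlus (h₁ : IsChannel W₁) (x : ZMod 2) (y₂ : Y₂) :
    ∑ y₁, ∑ u, polarPlus W₁ W₂ x (y₁, y₂, u) = W₂ x y₂ := by
  rw [Finset.sum_comm]
  simp [polarPlus, ← Finset.sum_mul, ← Finset.mul_sum, h₁.2]

lemma capacity_le_polarPlus (h₁ : IsChannel W₁) (h₂ : IsChannel W₂) :
    capacity W₂ ≤ capacity (polarPlus W₁ W₂) := by
  classical
  refine capacity_le_of_fiberwise_sum (polarPlus_nonneg h₁ h₂) (fun z => z.2.1) fun x y => ?_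
  rw [← sum_polarPlus (W₂ := W₂) h₁, Finset.sum_filter, Fintype.sum_prod_type]
  refine Finset.sum_congr rfl fun y₁ _ => ?_
  rw [Fintype.sum_prod_type_right]
  simp

lemma isChannel_polarPlus (h₁ : IsChannel W₁) (h₂ : IsChannel W₂) :
    IsChannel (polarPlus W₁ W₂) := by
  refine ⟨polarPlus_nonneg h₁ h₂, fun x => ?_⟩
  simp only [Fintype.sum_prod_type]
  rw [Finset.sum_comm]
  simp only [sum_polarPlus h₁, h₂.2]

lemma isChannel_polarMinus (h₁ : IsChannel W₁) (h₂ : IsChannel W₂) :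
    IsChannel (polarMinus W₁ W₂) := by
  refine ⟨fun x z => mul_nonneg (by norm_num) (Finset.sum_nonneg fun u _ =>
    mul_nonneg (h₁.1 _ _) (h₂.1 _ _)), fun x => ?_⟩
  simp only [polarMinus, Fintype.sum_prod_type, ← Finset.mul_sum]
  rw [Finset.sum_congr rfl fun _ _ => Finset.sum_comm, Finset.sum_comm]
  simp [← Finset.mul_sum, h₁.2, h₂.2]

end PolarTransforms

/-- for any BMSC W, the convolutional polarization step is at
least as strong as the polar one: I(W^{+̂}) ≥ I(W⁺), I(W^{-̂}) ≤ I(W⁻), and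
consequently I(W^{+̂}) − I(W^{-̂}) ≥ I(W⁺) − I(W⁻). -/
theorem conv_polarizes_more {Y : Type*} [Fintype Y] (W : ZMod 2 → Y → ℝ)
    (hW : IsBMSC W) :
    capacity (polarPlus W W) ≤ capacity (convPlus W) ∧
    capacity (convMinus W) ≤ capacity (polarMinus W W) ∧
    capacity (polarPlus W W) - capacity (polarMinus W W) ≤
      capacity (convPlus W) - capacity (convMinus W) := by
  have hm := isChannel_polarMinus hW.1 hW.1
  have hp := isChannel_polarPlus hW.1 hW.1
  have hplus : capacity (polarPlus W W) ≤ capacity (convPlus W) := capacity_le_polarPlus hm hp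
  have hminus : capacity (convMinus W) ≤ capacity (polarMinus W W) :=
    capacity_polarMinus_le hm hp
  exact ⟨hplus, hminus, sub_le_sub hplus hminus⟩
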